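/- arXiv:2601.21217 — 4 statements merged into one kernel-verified Lean document; each statement's English description precedes it below -/
import Mathlib

section
/- Tweedie's formula: let g be any probability measure on ℝ and s > 0. Define the normal-means marginal density m(z) = ∫ N(z; b, s²) dg(b) and let q_z be the probability measure on ℝ with density b ↦ N(z; b, s²)/m(z) with respect to g. Then for every z ∈ ℝ, q_z has a finite mean and E_{q_z}[b] = z + s² · m'(z)/m(z) = z + s² · (d/dz) log m(z). -/
open MeasureTheory ProbabilityTheory

/-- The Gaussian density `N(z; μ, s²) = (2πs²)^{-1/2} exp(-(z-μ)²/(2s²))`,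
where the third argument is the variance `s²`. -/
noncomputable def gauss (z μ s2 : ℝ) : ℝ :=
  (Real.sqrt (2 * Real.pi * s2))⁻¹ * Real.exp (-(z - μ) ^ 2 / (2 * s2))

lemma gauss_pos (z μ : ℝ) {v : ℝ} (hv : 0 < v) : 0 < gauss z μ v := by
  unfold gauss
  positivity

lemma continuous_gauss_mean (z v : ℝ) : Continuous fun b => gauss z b v := by
  unfold gauss
  fun_prop

lemma gauss_le (z μ : ℝ) {v : ℝ} (hv : 0 < v) : gauss z μ v ≤ (√(2 * Real.pi * v))⁻¹ := by
  unfold gauss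
  refine mul_le_of_le_one_right (by positivity) (Real.exp_le_one_iff.mpr ?_)
  rw [neg_div, neg_nonpos]
  positivity

lemma hasDerivAt_gauss (z μ : ℝ) {v : ℝ} (hv : 0 < v) :
    HasDerivAt (fun x => gauss x μ v) (gauss z μ v * ((μ - z) / v)) z := by
  unfold gauss
  have h : HasDerivAt (fun x => -(x - μ) ^ 2 / (2 * v)) ((μ - z) / v) z :=
    ((((hasDerivAt_id z).sub_const μ).pow 2).neg.div_const (2 * v)).congr_deriv (by
      simp only [id, Nat.cast_ofNat]
      field_simp
      ring)
  exact (h.exp.const_mul _).congr_deriv (mul_assoc _ _ _).symm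

lemma abs_mul_exp_neg_sq_le (t : ℝ) {v : ℝ} (hv : 0 < v) :
    |t| * Real.exp (-t ^ 2 / (2 * v)) ≤ 1 + 2 * v := by
  rw [neg_div, Real.exp_neg, ← div_eq_mul_inv, div_le_iff₀ (Real.exp_pos _)]
  have h := Real.add_one_le_exp (t ^ 2 / (2 * v))
  have ht : t ^ 2 + 1 ≤ (1 + 2 * v) * (t ^ 2 / (2 * v) + 1) := by
    have h0 : (1 + 2 * v) * (t ^ 2 / (2 * v) + 1) = t ^ 2 + 1 + (t ^ 2 / (2 * v) + 2 * v) := by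
      field_simp
      ring
    have h1 : 0 ≤ t ^ 2 / (2 * v) + 2 * v := by positivity
    linarith
  calc |t| ≤ t ^ 2 + 1 := by nlinarith [sq_abs t, sq_nonneg (|t| - 1), abs_nonneg t]
    _ ≤ (1 + 2 * v) * (t ^ 2 / (2 * v) + 1) := ht
    _ ≤ _ := by gcongr

lemma abs_gauss_mul_le (z μ : ℝ) {v : ℝ} (hv : 0 < v) :
    |gauss z μ v * ((μ - z) / v)| ≤ (√(2 * Real.pi * v))⁻¹ * (1 + 2 * v) / v := by
  rw [abs_mul, abs_of_pos (gauss_pos z μ hv), abs_div, abs_of_pos hv, ← mul_div_assoc,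
    abs_sub_comm, gauss, mul_assoc, mul_comm (Real.exp _)]
  gcongr
  exact abs_mul_exp_neg_sq_le (z - μ) hv

lemma integrable_gauss (g : Measure ℝ) [IsFiniteMeasure g] (z : ℝ) {v : ℝ} (hv : 0 < v) :
    Integrable (fun b => gauss z b v) g := by
  refine Integrable.of_bound (continuous_gauss_mean z v).aestronglyMeasurable
    (√(2 * Real.pi * v))⁻¹ (.of_forall fun b => ?_)
  rw [Real.norm_of_nonneg (gauss_pos z b hv).le]
  exact gauss_le z b hv

lemma hasDerivAt_integral_gauss (g : Measure ℝ) [IsFiniteMeasure g] (z : ℝ) {v : ℝ} (hv : 0 < v) :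
    Integrable (fun b => gauss z b v * ((b - z) / v)) g ∧
      HasDerivAt (fun x => ∫ b, gauss x b v ∂g) (∫ b, gauss z b v * ((b - z) / v) ∂g) z :=
  hasDerivAt_integral_of_dominated_loc_of_deriv_le
    (F' := fun x b => gauss x b v * ((b - x) / v)) Filter.univ_mem
    (.of_forall fun x => (continuous_gauss_mean x v).aestronglyMeasurable)
    (integrable_gauss g z hv)
    ((continuous_gauss_mean z v).mul (by fun_prop)).aestronglyMeasurable
    (.of_forall fun b x _ => abs_gauss_mul_le x b hv)
    (integrable_const _)
    (.of_forall fun b x _ => hasDerivAt_gauss x b hv)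

lemma integral_gauss_pos (g : Measure ℝ) [IsProbabilityMeasure g] (z : ℝ) {v : ℝ} (hv : 0 < v) :
    0 < ∫ b, gauss z b v ∂g := by
  rw [integral_pos_iff_support_of_nonneg (fun b => (gauss_pos z b hv).le)
    (integrable_gauss g z hv)]
  have h : (Function.support fun b => gauss z b v) = Set.univ :=
    Set.eq_univ_of_forall fun b => (gauss_pos z b hv).ne'
  simp [h]

/-- **Tweedie's formula**: for any probability measure `g` on `ℝ` and `s > 0`,
with marginal `m(z) = ∫ N(z; b, s²) dg(b)` and posterior `q_z` having density
`b ↦ N(z; b, s²)/m(z)` with respect to `g`, for every `z` the measure `q_z` has a finite mean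
and `E_{q_z}[b] = z + s² m'(z)/m(z) = z + s² (log m)'(z)`. -/
theorem tweedie_formula
    (g : Measure ℝ) [IsProbabilityMeasure g] (s : ℝ) (hs : 0 < s)
    (m : ℝ → ℝ) (hm : ∀ z, m z = ∫ b, gauss z b (s ^ 2) ∂g)
    (qz : ℝ → Measure ℝ)
    (hqz : ∀ z, qz z = g.withDensity fun b => ENNReal.ofReal (gauss z b (s ^ 2) / m z))
    (z : ℝ) :
    Integrable id (qz z) ∧
      (∫ b, b ∂(qz z)) = z + s ^ 2 * (deriv m z / m z) ∧
      z + s ^ 2 * (deriv m z / m z) = z + s ^ 2 * deriv (fun w => Real.log (m w)) z := by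
  have hv : 0 < s ^ 2 := by positivity
  have hmz : 0 < m z := hm z ▸ integral_gauss_pos g z hv
  obtain ⟨hI, hderiv⟩ := hasDerivAt_integral_gauss g z hv
  rw [← funext hm] at hderiv
  have hmeas : Measurable fun b => ENNReal.ofReal (gauss z b (s ^ 2) / m z) :=
    ((continuous_gauss_mean z _).measurable.div_const _).ennreal_ofReal
  have hlt : ∀ᵐ b ∂g, ENNReal.ofReal (gauss z b (s ^ 2) / m z) < ⊤ :=
    .of_forall fun _ => ENNReal.ofReal_lt_top
  have hdens : (fun b => (ENNReal.ofReal (gauss z b (s ^ 2) / m z)).toReal • b) = fun b =>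
      z / m z * gauss z b (s ^ 2) + s ^ 2 / m z * (gauss z b (s ^ 2) * ((b - z) / s ^ 2)) := by
    ext b
    rw [ENNReal.toReal_ofReal (div_pos (gauss_pos z b hv) hmz).le, smul_eq_mul]
    field_simp
    ring
  have hI₁ := (integrable_gauss g z hv).const_mul (z / m z)
  have hI₂ := hI.const_mul (s ^ 2 / m z)
  refine ⟨?_, ?_, ?_⟩
  · rw [hqz, integrable_withDensity_iff_integrable_smul' hmeas hlt]
    simp only [id]
    rw [hdens]
    exact hI₁.add hI₂
  · rw [hqz, integral_withDensity_eq_integral_toReal_smul hmeas hlt, hdens,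
      integral_add hI₁ hI₂, integral_const_mul, integral_const_mul, ← hm, hderiv.deriv]
    field_simp
  · rw [(hderiv.log hmz.ne').deriv, hderiv.deriv]
end

section
/- Let s > 0, b > 0, and x ∈ ℝ. Then ∫_0^∞ N(x; μ, s²) · (1/(2b)) e^{−μ/b} dμ = (1/(4b)) · exp((s² − 2bx)/(2b²)) · erfc((s² − bx)/(√(2s²) · b)). -/
open MeasureTheory

/-- The complementary error function `erfc(t) = (2/√π) ∫_t^∞ e^{-u²} du`. -/
noncomputable def erfc (t : ℝ) : ℝ :=
  2 / Real.sqrt Real.pi * ∫ u in Set.Ioi t, Real.exp (-u ^ 2)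

theorem integral_Ioi_comp_div_add (f : ℝ → ℝ) {r : ℝ} (hr : 0 < r) (t : ℝ) :
    ∫ μ in Set.Ioi (0 : ℝ), f (μ / r + t) = r * ∫ u in Set.Ioi t, f u := by
  have hscale := integral_comp_mul_left_Ioi (fun v => f (v + t)) 0 (inv_pos.mpr hr)
  have hshift := (measurePreserving_add_right volume t).setIntegral_preimage_emb
    (measurableEmbedding_addRight t) f (Set.Ioi t)
  simp only [Set.preimage_add_const_Ioi, sub_self] at hshift
  simp only [mul_zero, inv_inv, smul_eq_mul, hshift] at hscale
  rw [← hscale]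
  simp only [div_eq_inv_mul]

theorem gauss_mul_exp_eq_mul_exp_neg_sq {s b : ℝ} (hs : 0 < s) (hb : 0 < b) (x μ : ℝ) :
    gauss x μ (s ^ 2) * (1 / (2 * b)) * Real.exp (-μ / b)
      = (Real.sqrt (2 * Real.pi * s ^ 2))⁻¹ * (1 / (2 * b))
          * Real.exp ((s ^ 2 - 2 * b * x) / (2 * b ^ 2))
          * Real.exp (-(μ / Real.sqrt (2 * s ^ 2)
              + (s ^ 2 - b * x) / (Real.sqrt (2 * s ^ 2) * b)) ^ 2) := by
  have hr : 0 < Real.sqrt (2 * s ^ 2) := by positivity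
  have hr2 : Real.sqrt (2 * s ^ 2) ^ 2 = 2 * s ^ 2 := Real.sq_sqrt (by positivity)
  have hsq : (μ / Real.sqrt (2 * s ^ 2) + (s ^ 2 - b * x) / (Real.sqrt (2 * s ^ 2) * b)) ^ 2
      = (μ * b + (s ^ 2 - b * x)) ^ 2 / (2 * s ^ 2 * b ^ 2) := by
    rw [← hr2, Real.sqrt_sq hr.le]
    field_simp
  have hexp : -(x - μ) ^ 2 / (2 * s ^ 2) + -μ / b
      = (s ^ 2 - 2 * b * x) / (2 * b ^ 2)
        + -(μ / Real.sqrt (2 * s ^ 2) + (s ^ 2 - b * x) / (Real.sqrt (2 * s ^ 2) * b)) ^ 2 := by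
    rw [hsq]
    field_simp
    ring
  rw [mul_assoc _ (Real.exp _) (Real.exp _), ← Real.exp_add, ← hexp, Real.exp_add, gauss]
  ring

/-- for `s > 0`, `b > 0`, `x ∈ ℝ`,
`∫_0^∞ N(x; μ, s²) (1/(2b)) e^{-μ/b} dμ
  = (1/(4b)) exp((s² - 2bx)/(2b²)) erfc((s² - bx)/(√(2s²) b))`. -/
theorem gaussian_exponential_tail_integral_pos
    (s b x : ℝ) (hs : 0 < s) (hb : 0 < b) :
    ∫ μ in Set.Ioi (0 : ℝ), gauss x μ (s ^ 2) * (1 / (2 * b)) * Real.exp (-μ / b)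
      = (1 / (4 * b)) * Real.exp ((s ^ 2 - 2 * b * x) / (2 * b ^ 2))
          * erfc ((s ^ 2 - b * x) / (Real.sqrt (2 * s ^ 2) * b)) := by
  have hsqrt : Real.sqrt (2 * Real.pi * s ^ 2) = Real.sqrt Real.pi * Real.sqrt (2 * s ^ 2) := by
    rw [← Real.sqrt_mul Real.pi_pos.le]
    ring_nf
  have hr : 0 < Real.sqrt (2 * s ^ 2) := by positivity
  have hpi : 0 < Real.sqrt Real.pi := Real.sqrt_pos.mpr Real.pi_pos
  simp_rw [gauss_mul_exp_eq_mul_exp_neg_sq hs hb]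
  rw [integral_const_mul, integral_Ioi_comp_div_add (fun u => Real.exp (-u ^ 2)) hr, hsqrt, erfc]
  generalize Real.sqrt (2 * s ^ 2) = r at *
  field_simp
  ring
end

section
/- Let s > 0, b > 0, and x ∈ ℝ. Then ∫_{−∞}^0 N(x; μ, s²) · (1/(2b)) e^{μ/b} dμ = (1/(4b)) · exp((s² + 2bx)/(2b²)) · erfc((s² + bx)/(√(2s²) · b)). -/
open MeasureTheory

theorem integral_Ioi_eq_inv_mul_integral_Iio_comp_sub_div (g : ℝ → ℝ) (t : ℝ) {c : ℝ}
    (hc : 0 < c) :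
    ∫ u in Set.Ioi t, g u = c⁻¹ * ∫ y in Set.Iio (0 : ℝ), g (t - y / c) := by
  have hind : ∀ y, (Set.Iio (0 : ℝ)).indicator (fun y => g (t - y / c)) y
      = (Set.Ioi t).indicator g (t - y / c) := by
    intro y
    have hiff : t < t - y / c ↔ y < 0 := by
      rw [lt_sub_comm, sub_self, div_neg_iff]
      constructor
      · rintro (h | h)
        · linarith [h.2]
        · exact h.1
      · exact fun h => Or.inr ⟨h, hc⟩
    simp only [Set.indicator, Set.mem_Iio, Set.mem_Ioi, hiff]
  rw [← integral_indicator measurableSet_Iio, ← integral_indicator measurableSet_Ioi,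
    integral_congr_ae (Filter.Eventually.of_forall hind),
    Measure.integral_comp_div (fun u => (Set.Ioi t).indicator g (t - u)) c,
    integral_sub_left_eq_self (fun u => (Set.Ioi t).indicator g u) volume t,
    abs_of_pos hc, smul_eq_mul, inv_mul_cancel_left₀ hc.ne']

/-- for `s > 0`, `b > 0`, `x ∈ ℝ`,
`∫_{-∞}^0 N(x; μ, s²) (1/(2b)) e^{μ/b} dμ
  = (1/(4b)) exp((s² + 2bx)/(2b²)) erfc((s² + bx)/(√(2s²) b))`. -/
theorem gaussian_exponential_tail_integral_neg
    (s b x : ℝ) (hs : 0 < s) (hb : 0 < b) :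
    ∫ μ in Set.Iio (0 : ℝ), gauss x μ (s ^ 2) * (1 / (2 * b)) * Real.exp (μ / b)
      = (1 / (4 * b)) * Real.exp ((s ^ 2 + 2 * b * x) / (2 * b ^ 2))
          * erfc ((s ^ 2 + b * x) / (Real.sqrt (2 * s ^ 2) * b)) := by
  have hsqrt : Real.sqrt (2 * s ^ 2) = Real.sqrt 2 * s := by
    rw [Real.sqrt_mul (by norm_num), Real.sqrt_sq hs.le]
  have hsqrt_pi : Real.sqrt (2 * Real.pi * s ^ 2) = Real.sqrt 2 * Real.sqrt Real.pi * s := by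
    rw [Real.sqrt_mul (by positivity), Real.sqrt_mul (by norm_num), Real.sqrt_sq hs.le]
  have h2 : Real.sqrt 2 ^ 2 = 2 := Real.sq_sqrt (by norm_num)
  have h2pos : 0 < Real.sqrt 2 := by positivity
  have hpi : 0 < Real.sqrt Real.pi := Real.sqrt_pos.mpr Real.pi_pos
  rw [erfc, hsqrt, integral_Ioi_eq_inv_mul_integral_Iio_comp_sub_div _ _ (mul_pos h2pos hs)]
  simp only [← integral_const_mul]
  congr 1
  ext μ
  have hexp : Real.exp (-(x - μ) ^ 2 / (2 * s ^ 2)) * Real.exp (μ / b)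
      = Real.exp ((s ^ 2 + 2 * b * x) / (2 * b ^ 2)) *
        Real.exp (-((s ^ 2 + b * x) / (Real.sqrt 2 * s * b) - μ / (Real.sqrt 2 * s)) ^ 2) := by
    rw [← Real.exp_add, ← Real.exp_add]
    have hsq : ((s ^ 2 + b * x) / (Real.sqrt 2 * s * b) - μ / (Real.sqrt 2 * s)) ^ 2
        = (s ^ 2 + b * x - b * μ) ^ 2 / (2 * s ^ 2 * b ^ 2) := by
      field_simp
      rw [h2, mul_comm]
    rw [hsq]
    congr 1
    field_simp
    ring
  rw [gauss, hsqrt_pi]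
  calc _ = (Real.sqrt 2 * Real.sqrt Real.pi * s)⁻¹ * (1 / (2 * b)) *
        (Real.exp (-(x - μ) ^ 2 / (2 * s ^ 2)) * Real.exp (μ / b)) := by ring
    _ = _ := by
      rw [hexp]
      field_simp
      norm_num
end

section
/- Point-Laplace marginal: let π₀ ∈ [0,1], s > 0, b > 0, and x ∈ ℝ. Define the point-Laplace marginal likelihood L(x; π₀, b) = π₀ N(x; 0, s²) + (1 − π₀) ∫_{−∞}^∞ N(x; μ, s²) · (1/(2b)) e^{−|μ|/b} dμ. Then L(x; π₀, b) = π₀ N(x; 0, s²) + (1 − π₀) · (1/(4b)) · exp((s² − 2bx)/(2b²)) · erfc((s² − bx)/(√(2s²) · b)) + (1 − π₀) · (1/(4b)) · exp((s² + 2bx)/(2b²)) · erfc((s² + bx)/(√(2s²) · b)). -/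
open MeasureTheory

lemma integral_exp_neg_add_sq_Ioi (t : ℝ) :
    ∫ u in Set.Ioi (0 : ℝ), Real.exp (-(u + t) ^ 2) = Real.sqrt Real.pi / 2 * erfc t := by
  have h := (measurePreserving_add_right volume t).setIntegral_preimage_emb
    (measurableEmbedding_addRight t) (fun u : ℝ => Real.exp (-u ^ 2)) (Set.Ioi t)
  have hpre : (fun u : ℝ => u + t) ⁻¹' Set.Ioi t = Set.Ioi 0 := by
    ext u; simp
  rw [hpre] at h
  have hpi : Real.sqrt Real.pi ≠ 0 := (Real.sqrt_pos.2 Real.pi_pos).ne'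
  rw [h, erfc]
  field_simp

lemma gauss_neg_neg (z μ s2 : ℝ) : gauss (-z) (-μ) s2 = gauss z μ s2 := by
  simp only [gauss]
  congr 3
  ring

lemma integrable_gauss_mean {s : ℝ} (hs : 0 < s) (x : ℝ) :
    Integrable (fun μ => gauss x μ (s ^ 2)) := by
  have h := (integrable_exp_neg_mul_sq (b := 1 / (2 * s ^ 2)) (by positivity)).comp_sub_right x
  refine (h.const_mul (Real.sqrt (2 * Real.pi * s ^ 2))⁻¹).congr (.of_forall fun μ => ?_)
  simp only [gauss]
  congr 2
  ring

lemma integrable_gauss_mul_laplace {s b : ℝ} (hs : 0 < s) (hb : 0 < b) (x : ℝ) :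
    Integrable (fun μ => gauss x μ (s ^ 2) * (1 / (2 * b)) * Real.exp (-|μ| / b)) := by
  refine ((integrable_gauss_mean hs x).mul_const _).mul_bdd (c := 1)
    (by fun_prop) (.of_forall fun μ => ?_)
  rw [Real.norm_eq_abs, Real.abs_exp, Real.exp_le_one_iff]
  exact div_nonpos_of_nonpos_of_nonneg (by simp) hb.le

lemma gauss_mul_exp {s b : ℝ} (hs : 0 < s) (hb : 0 < b) (x μ : ℝ) :
    gauss x μ (s ^ 2) * Real.exp (-μ / b) =
      (Real.sqrt (2 * Real.pi * s ^ 2))⁻¹ * Real.exp ((s ^ 2 - 2 * b * x) / (2 * b ^ 2)) *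
        Real.exp (-((Real.sqrt (2 * s ^ 2))⁻¹ * μ
          + (s ^ 2 - b * x) / (Real.sqrt (2 * s ^ 2) * b)) ^ 2) := by
  have hc : 0 < Real.sqrt (2 * s ^ 2) := Real.sqrt_pos.2 (by positivity)
  have hsq : Real.sqrt (2 * s ^ 2) ^ 2 = 2 * s ^ 2 := Real.sq_sqrt (by positivity)
  rw [gauss, mul_assoc _ (Real.exp _), mul_assoc _ (Real.exp _), ← Real.exp_add, ← Real.exp_add]
  congr 2
  have hsquare : ((Real.sqrt (2 * s ^ 2))⁻¹ * μ
      + (s ^ 2 - b * x) / (Real.sqrt (2 * s ^ 2) * b)) ^ 2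
      = (μ + (s ^ 2 - b * x) / b) ^ 2 / (2 * s ^ 2) := by
    conv_rhs => rw [← hsq]
    field_simp
  rw [hsquare]
  field_simp
  ring

/-- The Gaussian likelihood integrated against one exponential tail. -/
lemma integral_Ioi_gauss_mul_exp {s b : ℝ} (hs : 0 < s) (hb : 0 < b) (x : ℝ) :
    ∫ μ in Set.Ioi 0, gauss x μ (s ^ 2) * Real.exp (-μ / b) =
      1 / 2 * Real.exp ((s ^ 2 - 2 * b * x) / (2 * b ^ 2))
        * erfc ((s ^ 2 - b * x) / (Real.sqrt (2 * s ^ 2) * b)) := by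
  have hc : 0 < Real.sqrt (2 * s ^ 2) := Real.sqrt_pos.2 (by positivity)
  have hpi : 0 < Real.sqrt Real.pi := Real.sqrt_pos.2 Real.pi_pos
  have hmul : Real.sqrt (2 * Real.pi * s ^ 2) = Real.sqrt Real.pi * Real.sqrt (2 * s ^ 2) := by
    rw [← Real.sqrt_mul Real.pi_pos.le]
    congr 1
    ring
  simp only [gauss_mul_exp hs hb]
  rw [integral_const_mul, integral_comp_mul_left_Ioi
    (fun u => Real.exp (-(u + (s ^ 2 - b * x) / (Real.sqrt (2 * s ^ 2) * b)) ^ 2)) 0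
    (inv_pos.2 hc), mul_zero, integral_exp_neg_add_sq_Ioi, hmul, inv_inv, smul_eq_mul]
  field_simp

/-- The Laplace marginal as the sum of its two one-sided contributions. -/
lemma integral_gauss_mul_laplace {s b : ℝ} (hs : 0 < s) (hb : 0 < b) (x : ℝ) :
    ∫ μ, gauss x μ (s ^ 2) * (1 / (2 * b)) * Real.exp (-|μ| / b) =
      1 / (4 * b) * Real.exp ((s ^ 2 - 2 * b * x) / (2 * b ^ 2))
          * erfc ((s ^ 2 - b * x) / (Real.sqrt (2 * s ^ 2) * b))
        + 1 / (4 * b) * Real.exp ((s ^ 2 + 2 * b * x) / (2 * b ^ 2))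
          * erfc ((s ^ 2 + b * x) / (Real.sqrt (2 * s ^ 2) * b)) := by
  have hint := integrable_gauss_mul_laplace hs hb x
  have hright (y : ℝ) :
      ∫ μ in Set.Ioi 0, gauss y μ (s ^ 2) * (1 / (2 * b)) * Real.exp (-|μ| / b) =
        1 / (4 * b) * Real.exp ((s ^ 2 - 2 * b * y) / (2 * b ^ 2))
          * erfc ((s ^ 2 - b * y) / (Real.sqrt (2 * s ^ 2) * b)) := by
    have hcongr : ∀ μ ∈ Set.Ioi (0 : ℝ),
        gauss y μ (s ^ 2) * (1 / (2 * b)) * Real.exp (-|μ| / b) =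
          1 / (2 * b) * (gauss y μ (s ^ 2) * Real.exp (-μ / b)) := by
      intro μ hμ
      rw [abs_of_pos hμ]
      ring
    rw [setIntegral_congr_fun measurableSet_Ioi hcongr, integral_const_mul,
      integral_Ioi_gauss_mul_exp hs hb]
    ring
  have hleft :
      ∫ μ in Set.Iic 0, gauss x μ (s ^ 2) * (1 / (2 * b)) * Real.exp (-|μ| / b) =
        ∫ μ in Set.Ioi 0, gauss (-x) μ (s ^ 2) * (1 / (2 * b)) * Real.exp (-|μ| / b) := by
    have h := integral_comp_neg_Iic 0
      (fun μ => gauss (-x) μ (s ^ 2) * (1 / (2 * b)) * Real.exp (-|μ| / b))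
    simpa only [gauss_neg_neg, abs_neg, neg_zero] using h
  rw [← intervalIntegral.integral_Iic_add_Ioi hint.integrableOn hint.integrableOn, hleft,
    hright, hright, add_comm]
  simp only [mul_neg, sub_neg_eq_add]

/-- **point-Laplace marginal**: for `π₀ ∈ [0,1]`, `s > 0`, `b > 0`, `x ∈ ℝ`,
the point-Laplace marginal likelihood
`L(x; π₀, b) = π₀ N(x; 0, s²) + (1 - π₀) ∫ N(x; μ, s²) (1/(2b)) e^{-|μ|/b} dμ`
has the closed form in terms of `erfc` given below. -/
theorem point_laplace_marginal
    (π0 s b x : ℝ) (hπ0 : π0 ∈ Set.Icc (0 : ℝ) 1) (hs : 0 < s) (hb : 0 < b)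
    (L : ℝ)
    (hL : L = π0 * gauss x 0 (s ^ 2)
        + (1 - π0) * ∫ μ, gauss x μ (s ^ 2) * (1 / (2 * b)) * Real.exp (-|μ| / b)) :
    L = π0 * gauss x 0 (s ^ 2)
      + (1 - π0) * ((1 / (4 * b)) * Real.exp ((s ^ 2 - 2 * b * x) / (2 * b ^ 2))
          * erfc ((s ^ 2 - b * x) / (Real.sqrt (2 * s ^ 2) * b)))
      + (1 - π0) * ((1 / (4 * b)) * Real.exp ((s ^ 2 + 2 * b * x) / (2 * b ^ 2))
          * erfc ((s ^ 2 + b * x) / (Real.sqrt (2 * s ^ 2) * b))) := by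
  rw [hL, integral_gauss_mul_laplace hs hb]
  ring
end
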